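/- arXiv:2002.12640 — 5 statements merged into one kernel-verified Lean document; each statement's English description precedes it below -/
import Mathlib

section
/- Let (μ_i)_{i∈ℕ} be a sequence of strictly positive real numbers, (g_i)_{i∈ℕ} a square-summable sequence of real numbers, 0 < β ≤ 2 and λ > 0. Then ∑_{i∈ℕ} λ²·μ_i^β·g_i² / (μ_i + λ)² ≤ λ^β · ∑_{i∈ℕ} g_i². -/
open scoped BigOperators

lemma sq_mul_rpow_le_rpow_mul_add_sq {m l β : ℝ} (hm : 0 ≤ m) (hl : 0 < l)
    (hβ0 : 0 ≤ β) (hβ2 : β ≤ 2) : l ^ 2 * m ^ β ≤ l ^ β * (m + l) ^ 2 := by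
  have split (x : ℝ) (hx : 0 < x) : x ^ 2 = x ^ β * x ^ (2 - β) := by
    rw [← Real.rpow_add hx, add_sub_cancel, Real.rpow_two]
  have h₁ : l ^ (2 - β) ≤ (m + l) ^ (2 - β) :=
    Real.rpow_le_rpow hl.le (by linarith) (by linarith)
  have h₂ : m ^ β ≤ (m + l) ^ β := Real.rpow_le_rpow hm (by linarith) hβ0
  calc l ^ 2 * m ^ β = l ^ β * (m ^ β * l ^ (2 - β)) := by rw [split l hl]; ring
    _ ≤ l ^ β * ((m + l) ^ β * (m + l) ^ (2 - β)) := by gcongr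
    _ = l ^ β * (m + l) ^ 2 := by rw [split (m + l) (by linarith)]

/-- Spectral form of the approximation-error bound for regularized least squares:
`∑ λ² μ_i^β g_i² / (μ_i+λ)² ≤ λ^β ∑ g_i²` for `0 < β ≤ 2` and `λ > 0`. -/
theorem approx_error_spectral_bound (μ : ℕ → ℝ) (hμ : ∀ i, 0 < μ i)
    (g : ℕ → ℝ) (hg : Summable (fun i => g i ^ 2))
    (β : ℝ) (hβ0 : 0 < β) (hβ2 : β ≤ 2) (lam : ℝ) (hlam : 0 < lam) :
    ∑' i : ℕ, lam ^ 2 * μ i ^ β * g i ^ 2 / (μ i + lam) ^ 2 ≤ lam ^ β * ∑' i : ℕ, g i ^ 2 := by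
  have hle (i : ℕ) :
      lam ^ 2 * μ i ^ β * g i ^ 2 / (μ i + lam) ^ 2 ≤ lam ^ β * g i ^ 2 := by
    have hi := hμ i
    rw [div_le_iff₀ (by positivity), mul_right_comm (lam ^ β)]
    exact mul_le_mul_of_nonneg_right
      (sq_mul_rpow_le_rpow_mul_add_sq hi.le hlam hβ0.le hβ2) (sq_nonneg _)
  have hsum := hg.mul_left (lam ^ β)
  have hnonneg (i : ℕ) : 0 ≤ lam ^ 2 * μ i ^ β * g i ^ 2 / (μ i + lam) ^ 2 := by
    have hi := hμ i
    positivity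
  rw [← tsum_mul_left]
  exact (hsum.of_nonneg_of_le hnonneg hle).tsum_le_tsum hle hsum
end

section
/- Let d ≥ 2 be an integer, 0 < δ < 1/2, γ > 0, and let (b_m)_{m≥0} be a sequence of strictly positive reals such that b_m ≤ γ·m^{−δ}·b_{m−1} for all m ≥ 1. Set α := 1/(1−2δ). Then for every m the series defining F_m converges, and there exists a constant C > 0 such that for all m ≥ 2: F_m ≤ C · m^{mδ/(2α) + 1/α} · b_m / (2^{m+1} · m^{(d−2)/2}). -/
open scoped BigOperators

/-- The degree-`m` spherical-harmonic eigenvalue (up to the fixed positive factor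
`|S^{d-2}| Γ((d-1)/2)`) of the integral operator of the dot-product kernel
`K(x,x') = ∑_m b_m ⟨x,x'⟩^m` on `S^{d-1}`. -/
noncomputable def sphEig (d : ℕ) (b : ℕ → ℝ) (m : ℕ) : ℝ :=
  (2 : ℝ) ^ (-(m + 1 : ℤ)) * ∑' s : ℕ,
    b (2 * s + m) * (((2 * s + m).factorial : ℝ) / ((2 * s).factorial : ℝ)) *
      Real.Gamma ((s : ℝ) + 1 / 2) / Real.Gamma ((s : ℝ) + (m : ℝ) + (d : ℝ) / 2)

/-- The `s`-th term of the series defining `sphEig d b m`. -/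
noncomputable def sphEigTerm (d : ℕ) (b : ℕ → ℝ) (m s : ℕ) : ℝ :=
  b (2 * s + m) * (((2 * s + m).factorial : ℝ) / ((2 * s).factorial : ℝ)) *
    Real.Gamma ((s : ℝ) + 1 / 2) / Real.Gamma ((s : ℝ) + (m : ℝ) + (d : ℝ) / 2)

lemma sphEigTerm_pos {d : ℕ} (hd : 2 ≤ d) {b : ℕ → ℝ} (hb : ∀ m, 0 < b m) (m s : ℕ) :
    0 < sphEigTerm d b m s := by
  have h1 : (2 : ℝ) ≤ d := by exact_mod_cast hd
  have h2 : 0 < Real.Gamma ((s : ℝ) + 1 / 2) := Real.Gamma_pos_of_pos (by positivity)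
  have h3 : 0 < Real.Gamma ((s : ℝ) + (m : ℝ) + (d : ℝ) / 2) :=
    Real.Gamma_pos_of_pos (by positivity)
  have h4 := hb (2 * s + m)
  unfold sphEigTerm
  positivity

/-- Log-convexity bound: `x ^ a * Γ (x + 1) ≤ Γ (x + 1 + a)`. -/
lemma Real.rpow_mul_Gamma_add_one_le {x a : ℝ} (hx : 0 < x) (ha : 0 ≤ a) :
    x ^ a * Real.Gamma (x + 1) ≤ Real.Gamma (x + 1 + a) := by
  rcases ha.eq_or_lt with rfl | ha
  · simp
  have hG : 0 < Real.Gamma x := Real.Gamma_pos_of_pos hx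
  have hG1 : 0 < Real.Gamma (x + 1) := Real.Gamma_pos_of_pos (by linarith)
  have hGa : 0 < Real.Gamma (x + 1 + a) := Real.Gamma_pos_of_pos (by linarith)
  have h := Real.convexOn_log_Gamma.slope_mono_adjacent (x := x) (y := x + 1) (z := x + 1 + a)
    hx (show 0 < x + 1 + a by linarith) (by linarith) (by linarith)
  have e1 : Real.log (Real.Gamma (x + 1)) = Real.log x + Real.log (Real.Gamma x) := by
    rw [Real.Gamma_add_one hx.ne', Real.log_mul hx.ne' hG.ne']
  simp only [Function.comp_apply, add_sub_cancel_left, div_one] at h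
  rw [le_div_iff₀ ha] at h
  rw [← Real.log_le_log_iff (by positivity) hGa,
    Real.log_mul (Real.rpow_pos_of_pos hx a).ne' hG1.ne', Real.log_rpow hx]
  nlinarith

/-- A sublinear power is dominated by a shifted linear function of small slope. -/
lemma exists_mul_rpow_le_add_natCast {ε : ℝ} (hε : ε < 1) (K : ℝ) :
    ∃ N : ℕ, ∀ x : ℝ, 1 ≤ x → K * x ^ ε ≤ (x + N) / 2 := by
  have hlim : Filter.Tendsto (fun x : ℝ => |K| * x ^ (-(1 - ε))) Filter.atTop (nhds 0) := by
    simpa using (tendsto_rpow_neg_atTop (sub_pos.2 hε)).const_mul |K|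
  obtain ⟨R, hR⟩ := Filter.eventually_atTop.1 (hlim.eventually_le_const (half_pos one_pos))
  obtain ⟨N, hN⟩ := exists_nat_ge (2 * (|K| * max R 1))
  refine ⟨N, fun x hx => ?_⟩
  have hx0 : 0 < x := by linarith
  have hKx : K * x ^ ε ≤ |K| * x ^ ε := by gcongr; exact le_abs_self K
  have hK : 0 ≤ |K| := abs_nonneg K
  rcases le_total R x with h | h
  · have h1 := mul_le_mul_of_nonneg_right (hR x h) hx0.le
    have h2 : x ^ (-(1 - ε)) * x = x ^ ε := by
      rw [← Real.rpow_add_one hx0.ne']; congr 1; ring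
    rw [mul_assoc, h2] at h1
    linarith [(Nat.cast_nonneg N : (0 : ℝ) ≤ N)]
  · have h1 : x ^ ε ≤ x := by
      simpa using Real.rpow_le_rpow_of_exponent_le hx hε.le
    have h2 : x ^ ε ≤ max R 1 := h1.trans (h.trans (le_max_left _ _))
    linarith [mul_le_mul_of_nonneg_left h2 hK]

/-- Exponentials are dominated by `m ^ (m * η)` for every `η > 0`. -/
lemma exists_two_pow_le_mul_rpow {η : ℝ} (hη : 0 < η) :
    ∃ C : ℝ, 0 < C ∧ ∀ m : ℕ, 1 ≤ m → (2 : ℝ) ^ m ≤ C * (m : ℝ) ^ ((m : ℝ) * η) := by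
  obtain ⟨M, hM⟩ := exists_nat_ge ((2 : ℝ) ^ (1 / η))
  refine ⟨2 ^ M, by positivity, fun m hm => ?_⟩
  have hm1 : (1 : ℝ) ≤ m := by exact_mod_cast hm
  rcases le_total m M with h | h
  · have h1 : (2 : ℝ) ^ m ≤ 2 ^ M := pow_le_pow_right₀ one_le_two h
    have h2 : (1 : ℝ) ≤ (m : ℝ) ^ ((m : ℝ) * η) := Real.one_le_rpow hm1 (by positivity)
    exact h1.trans (le_mul_of_one_le_right (by positivity) h2)
  · have h1 : (2 : ℝ) ≤ (m : ℝ) ^ η := by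
      have h2 : (2 : ℝ) ^ (1 / η) ≤ m := hM.trans (by exact_mod_cast h)
      have h3 := Real.rpow_le_rpow (by positivity) h2 hη.le
      rwa [← Real.rpow_mul (by norm_num), one_div_mul_cancel hη.ne', Real.rpow_one] at h3
    have h2 : (2 : ℝ) ^ m ≤ (m : ℝ) ^ ((m : ℝ) * η) := by
      rw [mul_comm, Real.rpow_mul (by positivity), Real.rpow_natCast]
      gcongr
    have h3 : (1 : ℝ) ≤ 2 ^ M := one_le_pow₀ one_le_two
    nlinarith [show (0 : ℝ) ≤ (m : ℝ) ^ ((m : ℝ) * η) by positivity]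

/-- Ratio bound for consecutive terms of the series defining `sphEig d b m`. -/
lemma sphEigTerm_succ_le {d : ℕ} (hd : 2 ≤ d) {δ γ : ℝ} (hδ0 : 0 < δ) (hδ : δ < 1)
    (hγ : 0 < γ) {b : ℕ → ℝ} (hb : ∀ m, 0 < b m)
    (hrec : ∀ m : ℕ, 1 ≤ m → b m ≤ γ * (m : ℝ) ^ (-δ) * b (m - 1)) (m s : ℕ) :
    sphEigTerm d b m (s + 1) ≤
      sphEigTerm d b m s * (γ ^ 2 * ((m : ℝ) + s + 1) ^ (1 - 2 * δ) / (s + 1)) := by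
  have hd' : (1 : ℝ) ≤ (d : ℝ) / 2 := by
    have : (2 : ℝ) ≤ d := by exact_mod_cast hd
    linarith
  set p : ℝ := 2 * s + m + 1 with hp
  have hp0 : 0 < p := by positivity
  set x : ℝ := (m : ℝ) + s + 1 with hx
  have hx0 : 0 < x := by positivity
  set y : ℝ := (s : ℝ) + m + d / 2 with hy
  have hxy : x ≤ y := by rw [hx, hy]; linarith
  have hy0 : 0 < y := hx0.trans_le hxy
  have hg : 0 < Real.Gamma ((s : ℝ) + 1 / 2) := Real.Gamma_pos_of_pos (by positivity)
  have hG : 0 < Real.Gamma y := Real.Gamma_pos_of_pos hy0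
  have hb2 : b (2 * (s + 1) + m) ≤ γ ^ 2 * (p * (p + 1)) ^ (-δ) * b (2 * s + m) := by
    have h1 := hrec (2 * s + m + 1) (by omega)
    have h2 := hrec (2 * s + m + 2) (by omega)
    rw [show 2 * s + m + 1 - 1 = 2 * s + m by omega,
      show ((2 * s + m + 1 : ℕ) : ℝ) = p by rw [hp]; push_cast; ring] at h1
    rw [show 2 * s + m + 2 - 1 = 2 * s + m + 1 by omega,
      show ((2 * s + m + 2 : ℕ) : ℝ) = p + 1 by rw [hp]; push_cast; ring] at h2
    rw [show 2 * (s + 1) + m = 2 * s + m + 2 by ring, Real.mul_rpow hp0.le (by positivity)]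
    calc _ ≤ _ := h2
      _ ≤ γ * (p + 1) ^ (-δ) * (γ * p ^ (-δ) * b (2 * s + m)) := by gcongr
      _ = _ := by ring
  have hf1 : ((2 * (s + 1) + m).factorial : ℝ) = (p + 1) * (p * (2 * s + m).factorial) := by
    rw [show 2 * (s + 1) + m = 2 * s + m + 1 + 1 by ring, Nat.factorial_succ,
      Nat.factorial_succ, hp]
    push_cast; ring
  have hf2 : ((2 * (s + 1)).factorial : ℝ) = (2 * s + 2) * ((2 * s + 1) * (2 * s).factorial) := by
    rw [show 2 * (s + 1) = 2 * s + 1 + 1 by ring, Nat.factorial_succ, Nat.factorial_succ]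
    push_cast; ring
  have hg1 : Real.Gamma (((s + 1 : ℕ) : ℝ) + 1 / 2) =
      ((s : ℝ) + 1 / 2) * Real.Gamma ((s : ℝ) + 1 / 2) := by
    rw [← Real.Gamma_add_one (by positivity)]; congr 1; push_cast; ring
  have hG1 : Real.Gamma (((s + 1 : ℕ) : ℝ) + m + d / 2) = y * Real.Gamma y := by
    rw [← Real.Gamma_add_one hy0.ne']; congr 1; rw [hy]; push_cast; ring
  have hpp : (p * (p + 1)) ^ (-δ) * (p * (p + 1)) / (4 * y) ≤ x ^ (1 - 2 * δ) := by
    have h1 : (p * (p + 1)) ^ (-δ) * (p * (p + 1)) = (p * (p + 1)) ^ (1 - δ) := by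
      rw [← Real.rpow_add_one (by positivity)]; congr 1; ring
    have h2 : p * (p + 1) ≤ 4 * x ^ 2 := by
      have ha : p ≤ 2 * x := by
        rw [hp, hx]; linarith [(Nat.cast_nonneg m : (0 : ℝ) ≤ m)]
      have hc : p + 1 ≤ 2 * x := by
        rw [hp, hx]; linarith [(Nat.cast_nonneg m : (0 : ℝ) ≤ m)]
      nlinarith
    have h3 : (4 * x ^ 2) ^ (1 - δ) ≤ 4 * (x ^ (1 - 2 * δ) * x) := by
      rw [Real.mul_rpow (by norm_num) (by positivity)]
      have h4 : (4 : ℝ) ^ (1 - δ) ≤ 4 := by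
        simpa using Real.rpow_le_rpow_of_exponent_le (x := (4 : ℝ)) (by norm_num)
          (show 1 - δ ≤ 1 by linarith)
      have h5 : (x ^ 2) ^ (1 - δ) = x ^ (1 - 2 * δ) * x := by
        rw [← Real.rpow_add_one hx0.ne', ← Real.rpow_natCast, ← Real.rpow_mul hx0.le]
        congr 1; push_cast; ring
      rw [h5]
      gcongr
    rw [h1, div_le_iff₀ (by positivity)]
    calc _ ≤ (4 * x ^ 2) ^ (1 - δ) := Real.rpow_le_rpow (by positivity) h2 (by linarith)
      _ ≤ 4 * (x ^ (1 - 2 * δ) * x) := h3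
      _ ≤ 4 * (x ^ (1 - 2 * δ) * y) := by gcongr
      _ = _ := by ring
  have hT := sphEigTerm_pos hd hb m s
  calc sphEigTerm d b m (s + 1)
      ≤ γ ^ 2 * (p * (p + 1)) ^ (-δ) * b (2 * s + m) *
          (((2 * (s + 1) + m).factorial : ℝ) / ((2 * (s + 1)).factorial : ℝ)) *
          Real.Gamma (((s + 1 : ℕ) : ℝ) + 1 / 2) /
          Real.Gamma (((s + 1 : ℕ) : ℝ) + m + d / 2) := by
        unfold sphEigTerm
        rw [hg1, hG1]
        gcongr
    _ = sphEigTerm d b m s *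
          (γ ^ 2 * ((p * (p + 1)) ^ (-δ) * (p * (p + 1)) / (4 * y)) / (s + 1)) := by
        unfold sphEigTerm
        rw [hf1, hf2, hg1, hG1, ← hy]
        generalize (p * (p + 1)) ^ (-δ) = r
        field_simp
        ring
    _ ≤ _ := by gcongr

/-- Negative-binomial majorant for the series defining `sphEig d b m`. -/
lemma sphEigTerm_le_choose {d : ℕ} (hd : 2 ≤ d) {δ γ : ℝ} (hδ0 : 0 < δ) (hδ : δ < 1)
    (hγ : 0 < γ) {b : ℕ → ℝ} (hb : ∀ m, 0 < b m)
    (hrec : ∀ m : ℕ, 1 ≤ m → b m ≤ γ * (m : ℝ) ^ (-δ) * b (m - 1)) {N : ℕ}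
    (hN : ∀ x : ℝ, 1 ≤ x → γ ^ 2 * x ^ (1 - 2 * δ) ≤ (x + N) / 2) (m s : ℕ) :
    sphEigTerm d b m s ≤
      sphEigTerm d b m 0 * (((s + (m + N)).choose (m + N) : ℝ) * (1 / 2) ^ s) := by
  induction s with
  | zero => simp
  | succ s ih =>
    have hx := hN ((m : ℝ) + s + 1) (by linarith [(Nat.cast_nonneg m : (0 : ℝ) ≤ m),
      (Nat.cast_nonneg s : (0 : ℝ) ≤ s)])
    have hT := sphEigTerm_pos hd hb m s
    have hc : (((s + 1 + (m + N)).choose (m + N) : ℕ) : ℝ) * (s + 1) =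
        ((s + (m + N)).choose (m + N) : ℝ) * (m + s + 1 + N) := by
      have h := Nat.choose_mul_succ_eq (s + (m + N)) (m + N)
      rw [show s + (m + N) + 1 - (m + N) = s + 1 by omega,
        show s + (m + N) + 1 = s + 1 + (m + N) by ring] at h
      have h' := congrArg (Nat.cast : ℕ → ℝ) h
      push_cast at h'
      linear_combination -h'
    calc sphEigTerm d b m (s + 1)
        ≤ sphEigTerm d b m s * (γ ^ 2 * ((m : ℝ) + s + 1) ^ (1 - 2 * δ) / (s + 1)) :=
          sphEigTerm_succ_le hd hδ0 hδ hγ hb hrec m s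
      _ ≤ sphEigTerm d b m 0 * (((s + (m + N)).choose (m + N) : ℝ) * (1 / 2) ^ s) *
          ((((m : ℝ) + s + 1) + N) / 2 / (s + 1)) := by
        have := hT.le.trans ih
        gcongr
      _ = sphEigTerm d b m 0 * (((s + (m + N)).choose (m + N) : ℝ) * (m + s + 1 + N) / (s + 1) *
          (1 / 2) ^ (s + 1)) := by rw [pow_succ]; ring
      _ = _ := by
        rw [← hc, mul_div_cancel_right₀ _ (by positivity)]

lemma sphEigTerm_zero_le {d : ℕ} (hd : 2 ≤ d) {b : ℕ → ℝ} (hb : ∀ m, 0 < b m) {m : ℕ}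
    (hm : 1 ≤ m) :
    sphEigTerm d b m 0 ≤ √Real.pi * b m / (m : ℝ) ^ (((d : ℝ) - 2) / 2) := by
  have hm0 : (0 : ℝ) < m := by exact_mod_cast hm
  have hd' : (2 : ℝ) ≤ d := by exact_mod_cast hd
  have h := Real.rpow_mul_Gamma_add_one_le (a := ((d : ℝ) - 2) / 2) hm0 (by linarith)
  rw [Real.Gamma_nat_eq_factorial,
    show (m : ℝ) + 1 + ((d : ℝ) - 2) / 2 = m + d / 2 by ring] at h
  have hG : 0 < Real.Gamma ((m : ℝ) + d / 2) := Real.Gamma_pos_of_pos (by positivity)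
  have hbm := hb m
  have e : sphEigTerm d b m 0 = √Real.pi * b m * m.factorial / Real.Gamma ((m : ℝ) + d / 2) := by
    simp only [sphEigTerm, mul_zero, zero_add, Nat.cast_zero, Nat.factorial_zero, Nat.cast_one,
      div_one, Real.Gamma_one_half_eq]
    ring
  rw [e, div_le_div_iff₀ hG (by positivity)]
  calc _ = √Real.pi * b m * ((m : ℝ) ^ (((d : ℝ) - 2) / 2) * m.factorial) := by ring
    _ ≤ _ := by gcongr

/-- Super-geometric regime, `0 < δ < 1/2`: if `b_m ≤ γ m^{-δ} b_{m-1}`, then with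
`α := 1/(1−2δ)` one has `F_m ≤ C m^{mδ/(2α)+1/α} b_m / (2^{m+1} m^{(d−2)/2})`. -/
theorem sphEig_supergeometric_bound (d : ℕ) (hd : 2 ≤ d) (δ γ : ℝ)
    (hδ0 : 0 < δ) (hδ : δ < 1 / 2) (hγ : 0 < γ)
    (b : ℕ → ℝ) (hb : ∀ m, 0 < b m)
    (hrec : ∀ m : ℕ, 1 ≤ m → b m ≤ γ * (m : ℝ) ^ (-δ) * b (m - 1))
    (α : ℝ) (hα : α = 1 / (1 - 2 * δ)) :
    (∀ m : ℕ, Summable (fun s : ℕ =>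
      b (2 * s + m) * (((2 * s + m).factorial : ℝ) / ((2 * s).factorial : ℝ)) *
        Real.Gamma ((s : ℝ) + 1 / 2) / Real.Gamma ((s : ℝ) + (m : ℝ) + (d : ℝ) / 2))) ∧
    ∃ C : ℝ, 0 < C ∧ ∀ m : ℕ, 2 ≤ m →
      sphEig d b m ≤
        C * (m : ℝ) ^ ((m : ℝ) * δ / (2 * α) + 1 / α) * b m /
          ((2 : ℝ) ^ (m + 1) * (m : ℝ) ^ (((d : ℝ) - 2) / 2)) := by
  have hε : 0 < 1 - 2 * δ := by linarith
  obtain ⟨N, hN⟩ := exists_mul_rpow_le_add_natCast (show 1 - 2 * δ < 1 by linarith) (γ ^ 2)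
  have hle := sphEigTerm_le_choose hd hδ0 (by linarith) hγ hb hrec hN
  have hmaj : ∀ m : ℕ, HasSum
      (fun s : ℕ => sphEigTerm d b m 0 * (((s + (m + N)).choose (m + N) : ℝ) * (1 / 2) ^ s))
      (sphEigTerm d b m 0 * 2 ^ (m + N + 1)) := by
    intro m
    have h := (hasSum_choose_mul_geometric_of_norm_lt_one (m + N)
      (show ‖(1 / 2 : ℝ)‖ < 1 by norm_num)).mul_left (sphEigTerm d b m 0)
    have e : (1 : ℝ) / (1 - 1 / 2) ^ (m + N + 1) = 2 ^ (m + N + 1) := by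
      rw [← one_div_pow]; norm_num
    rwa [e] at h
  have hsum : ∀ m : ℕ, Summable (sphEigTerm d b m) := fun m =>
    Summable.of_nonneg_of_le (fun s => (sphEigTerm_pos hd hb m s).le) (hle m) (hmaj m).summable
  refine ⟨hsum, ?_⟩
  obtain ⟨C, hC, hC2⟩ := exists_two_pow_le_mul_rpow
    (show 0 < δ * (1 - 2 * δ) / 2 by positivity)
  refine ⟨√Real.pi * 2 ^ (N + 1) * C, by positivity, fun m hm => ?_⟩
  have hm1 : (1 : ℝ) ≤ m := by exact_mod_cast (by omega : 1 ≤ m)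
  have hm0 : (0 : ℝ) < m := by linarith
  have hbm := hb m
  have hpow : (2 : ℝ) ^ m ≤ C * (m : ℝ) ^ ((m : ℝ) * δ / (2 * α) + 1 / α) := by
    refine (hC2 m (by omega)).trans ?_
    gcongr
    have h : (m : ℝ) * δ / (2 * α) + 1 / α =
        m * (δ * (1 - 2 * δ) / 2) + (1 - 2 * δ) := by
      rw [hα]; field_simp
    rw [h]; linarith
  have htsum : ∑' s, sphEigTerm d b m s ≤ sphEigTerm d b m 0 * 2 ^ (m + N + 1) :=
    (hmaj m).tsum_eq ▸ (hsum m).tsum_le_tsum (hle m) (hmaj m).summable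
  calc sphEig d b m = ((2 : ℝ) ^ (m + 1))⁻¹ * ∑' s, sphEigTerm d b m s := by
        rw [sphEig, zpow_neg]; rfl
    _ ≤ ((2 : ℝ) ^ (m + 1))⁻¹ * (√Real.pi * b m / (m : ℝ) ^ (((d : ℝ) - 2) / 2) *
          2 ^ (m + N + 1)) := by
        gcongr
        exact htsum.trans (by gcongr; exact sphEigTerm_zero_le hd hb (by omega))
    _ = √Real.pi * 2 ^ (N + 1) * 2 ^ m * b m /
          ((2 : ℝ) ^ (m + 1) * (m : ℝ) ^ (((d : ℝ) - 2) / 2)) := by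
        field_simp
        ring
    _ ≤ √Real.pi * 2 ^ (N + 1) * (C * (m : ℝ) ^ ((m : ℝ) * δ / (2 * α) + 1 / α)) * b m /
          ((2 : ℝ) ^ (m + 1) * (m : ℝ) ^ (((d : ℝ) - 2) / 2)) := by gcongr
    _ = _ := by ring
end

section
/- Let d ≥ 2 be an integer and (b_m)_{m≥0} a sequence of nonnegative real numbers such that for every m the series defining F_m converges, and such that (b_m) is eventually non-increasing (there is m₀ with b_{m+1} ≤ b_m for all m ≥ m₀). Then the sequence (F_m)_{m≥0} is eventually non-increasing: there exists k₀ such that F_{k+1} ≤ F_k for all k ≥ k₀. -/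
open scoped BigOperators

/-- The weights `((2s+m)!/(2s)!) Γ(s+1/2)/Γ(s+m+d/2)` grow by a factor at most `2` when `m`
increases by one. -/
theorem sphEig_weight_succ_le (d : ℕ) (hd : 2 ≤ d) (s k : ℕ) :
    (((2 * s + (k + 1)).factorial : ℝ) / ((2 * s).factorial : ℝ)) *
        Real.Gamma ((s : ℝ) + 1 / 2) / Real.Gamma ((s : ℝ) + ((k + 1 : ℕ) : ℝ) + (d : ℝ) / 2) ≤
      2 * ((((2 * s + k).factorial : ℝ) / ((2 * s).factorial : ℝ)) *
        Real.Gamma ((s : ℝ) + 1 / 2) / Real.Gamma ((s : ℝ) + (k : ℝ) + (d : ℝ) / 2)) := by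
  have hd' : (2 : ℝ) ≤ d := by exact_mod_cast hd
  have hx : 0 < (s : ℝ) + k + (d : ℝ) / 2 := by positivity
  have hG : Real.Gamma ((s : ℝ) + ((k + 1 : ℕ) : ℝ) + (d : ℝ) / 2) =
      ((s : ℝ) + k + (d : ℝ) / 2) * Real.Gamma ((s : ℝ) + k + (d : ℝ) / 2) := by
    rw [← Real.Gamma_add_one hx.ne']
    congr 1
    push_cast
    ring
  have hf : ((2 * s + (k + 1)).factorial : ℝ) =
      (2 * s + k + 1) * ((2 * s + k).factorial : ℝ) := by
    rw [← add_assoc, Nat.factorial_succ]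
    push_cast
    ring
  have hΓ : 0 < Real.Gamma ((s : ℝ) + k + (d : ℝ) / 2) := Real.Gamma_pos_of_pos hx
  have hΓ' : 0 < Real.Gamma ((s : ℝ) + 1 / 2) := Real.Gamma_pos_of_pos (by positivity)
  have hratio : (2 * s + k + 1 : ℝ) / (s + k + d / 2) ≤ 2 := by
    rw [div_le_iff₀ hx]
    have : (0 : ℝ) ≤ k := k.cast_nonneg
    linarith
  calc _ = (2 * s + k + 1 : ℝ) / (s + k + d / 2) *
        ((((2 * s + k).factorial : ℝ) / ((2 * s).factorial : ℝ)) *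
          Real.Gamma ((s : ℝ) + 1 / 2) / Real.Gamma ((s : ℝ) + (k : ℝ) + (d : ℝ) / 2)) := by
        rw [hG, hf]
        field_simp
    _ ≤ _ := mul_le_mul_of_nonneg_right hratio (by positivity)

/-- If the coefficient sequence `(b_m)` is eventually non-increasing, then so is the sequence
of spherical-harmonic eigenvalues `(F_m)`. -/
theorem sphEig_eventually_antitone (d : ℕ) (hd : 2 ≤ d)
    (b : ℕ → ℝ) (hb : ∀ m, 0 ≤ b m)
    (hsum : ∀ m : ℕ, Summable (fun s : ℕ =>
      b (2 * s + m) * (((2 * s + m).factorial : ℝ) / ((2 * s).factorial : ℝ)) *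
        Real.Gamma ((s : ℝ) + 1 / 2) / Real.Gamma ((s : ℝ) + (m : ℝ) + (d : ℝ) / 2)))
    (hmono : ∃ m₀ : ℕ, ∀ m, m₀ ≤ m → b (m + 1) ≤ b m) :
    ∃ k₀ : ℕ, ∀ k, k₀ ≤ k → sphEig d b (k + 1) ≤ sphEig d b k := by
  obtain ⟨m₀, hm⟩ := hmono
  refine ⟨m₀, fun k hk => ?_⟩
  have hpow : (2 : ℝ) ^ (-(k + 1 : ℤ)) = 2 ^ (-((k + 1 : ℕ) + 1 : ℤ)) * 2 := by
    rw [← zpow_add_one₀ two_ne_zero]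
    congr 1
  unfold sphEig
  rw [hpow, mul_assoc, ← tsum_mul_left (a := 2)]
  refine mul_le_mul_of_nonneg_left ?_ (by positivity)
  refine (hsum (k + 1)).tsum_le_tsum (fun s => ?_) ((hsum k).mul_left 2)
  have hΓ : 0 < Real.Gamma ((s : ℝ) + 1 / 2) := Real.Gamma_pos_of_pos (by positivity)
  have hΓ' : 0 < Real.Gamma ((s : ℝ) + ((k + 1 : ℕ) : ℝ) + (d : ℝ) / 2) :=
    Real.Gamma_pos_of_pos (by positivity)
  have key := mul_le_mul (hm (2 * s + k) (by omega)) (sphEig_weight_succ_le d hd s k)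
    (by positivity) (hb _)
  calc _ = _ := by rw [mul_assoc, mul_div_assoc, ← add_assoc]
    _ ≤ _ := key
    _ = _ := by ring
end

section
/- Let d ≥ 2 be an integer and let (μ_m)_{m≥1} be a summable sequence of nonnegative reals such that there exist γ > 0 and c > 0 with μ_m ≤ γ·m^{−c·m^{1/(d−1)}} for all m ≥ 1. Then there exist a constant C > 0 and λ₀ ∈ (0,1) such that for every λ with 0 < λ ≤ λ₀, the degrees of freedom satisfy df(λ) = ∑_{m≥1} μ_m/(μ_m + λ) ≤ C · (log(1/λ))^{d−1} / (log(log(1/λ)))^{d−1}. -/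
open scoped BigOperators

/-- Beyond the truncation level `(a L / log L)^k`, the super-geometric bound is at most
`exp (-L)` times the summable sequence `x⁻²`. -/
lemma rpow_neg_supergeometric_le {k : ℕ} (hk : 1 ≤ k) {c a L x : ℝ} (hc : 0 < c)
    (ha1 : 1 ≤ a) (ha : 4 ≤ c * a) (hL : 0 < L) (hlog : 1 ≤ Real.log L)
    (hsqrt : Real.log L ≤ √L) (hcL : 4 ≤ c * √L) (hx1 : 1 ≤ x)
    (hx : (a * (L / Real.log L)) ^ k ≤ x) :
    x ^ (-(c * x ^ (1 / (k : ℝ)))) ≤ Real.exp (-L) * (1 / x ^ 2) := by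
  have hl : 0 < Real.log L := by linarith
  have hs0 : 0 < √L := Real.sqrt_pos.2 hL
  have hk' : (1 : ℝ) ≤ k := by exact_mod_cast hk
  have hT : √L ≤ L / Real.log L := by
    rw [le_div_iff₀ hl]
    calc √L * Real.log L ≤ √L * √L := by gcongr
      _ = L := Real.mul_self_sqrt hL.le
  have hT0 : 0 < L / Real.log L := by positivity
  set s := x ^ (1 / (k : ℝ)) with hs
  have hsT : a * (L / Real.log L) ≤ s := by
    have h := Real.rpow_le_rpow (by positivity) hx (by positivity : 0 ≤ 1 / (k : ℝ))
    rwa [one_div, Real.pow_rpow_inv_natCast (by positivity) (by omega), ← one_div] at h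
  have hTs : L / Real.log L ≤ s := (le_mul_of_one_le_left hT0.le ha1).trans hsT
  have hsx : s ≤ x := by
    calc s ≤ x ^ (1 : ℝ) := Real.rpow_le_rpow_of_exponent_le hx1 (by
          rw [div_le_one (by positivity)]; exact hk')
      _ = x := Real.rpow_one x
  have hlogx : Real.log L / 2 ≤ Real.log x := by
    rw [← Real.log_sqrt hL.le]
    exact Real.log_le_log hs0 (by linarith)
  have hx0 : 0 < x := by linarith
  have h1 : 2 * L ≤ c * s * Real.log x := by
    calc 2 * L ≤ (c * a) * L / 2 := by nlinarith
      _ = c * (a * (L / Real.log L)) * (Real.log L / 2) := by field_simp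
      _ ≤ c * s * Real.log x := by gcongr
  have h2 : 4 * Real.log x ≤ c * s * Real.log x := by
    have : c * √L ≤ c * s := by gcongr; linarith
    exact mul_le_mul_of_nonneg_right (by linarith) (by linarith)
  have h3 : 1 / x ^ 2 = Real.exp (-(2 * Real.log x)) := by
    rw [Real.exp_neg, two_mul, Real.exp_add, Real.exp_log hx0, one_div, sq]
  rw [h3, ← Real.exp_add, Real.rpow_def_of_pos hx0, Real.exp_le_exp]
  linarith

/-- Under super-geometric eigenvalue decay `μ_m ≤ γ m^{−c m^{1/(d−1)}}`, the degrees of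
freedom satisfy `df(λ) ≤ C (log(1/λ))^{d−1} / (log log(1/λ))^{d−1}` for small `λ`. -/
theorem df_le_of_supergeometric_decay (d : ℕ) (hd : 2 ≤ d)
    (μ : ℕ → ℝ) (hμ0 : ∀ m, 1 ≤ m → 0 ≤ μ m)
    (hsum : Summable (fun m : ℕ => μ (m + 1)))
    (γ c : ℝ) (hγ : 0 < γ) (hc : 0 < c)
    (hdecay : ∀ m : ℕ, 1 ≤ m →
      μ m ≤ γ * (m : ℝ) ^ (-(c * (m : ℝ) ^ (1 / ((d : ℝ) - 1))))) :
    ∃ C : ℝ, 0 < C ∧ ∃ lam₀ : ℝ, 0 < lam₀ ∧ lam₀ < 1 ∧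
      ∀ lam : ℝ, 0 < lam → lam ≤ lam₀ →
        ∑' m : ℕ, μ (m + 1) / (μ (m + 1) + lam) ≤
          C * (Real.log (1 / lam)) ^ (d - 1) / (Real.log (Real.log (1 / lam))) ^ (d - 1) := by
  obtain ⟨k, rfl⟩ : ∃ k, d = k + 1 := ⟨d - 1, by omega⟩
  have hk : 1 ≤ k := by omega
  simp only [Nat.add_sub_cancel]
  simp only [Nat.cast_add, Nat.cast_one, add_sub_cancel_right] at hdecay
  have hS : Summable (fun m : ℕ => 1 / ((m + 1 : ℕ) : ℝ) ^ 2) :=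
    (summable_nat_add_iff 1).2 (Real.summable_one_div_nat_pow.2 one_lt_two)
  set S := ∑' m : ℕ, 1 / ((m + 1 : ℕ) : ℝ) ^ 2 with hSdef
  have hS0 : 0 ≤ S := tsum_nonneg fun m => by positivity
  set a : ℝ := max 1 (4 / c) with hadef
  have ha1 : 1 ≤ a := le_max_left _ _
  have ha : 4 ≤ c * a := by
    have : 4 / c ≤ a := le_max_right _ _
    rw [div_le_iff₀ hc] at this
    linarith
  have hev : ∀ᶠ L : ℝ in Filter.atTop, 1 ≤ Real.log L ∧ Real.log L ≤ √L ∧ 4 ≤ c * √L := by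
    have h1 := Real.tendsto_log_atTop.eventually_ge_atTop 1
    have h2 := (isLittleO_log_rpow_atTop (one_half_pos (α := ℝ))).bound one_pos
    have h3 := (Real.tendsto_sqrt_atTop.const_mul_atTop hc).eventually_ge_atTop 4
    filter_upwards [h1, h2, h3] with L h1 h2 h3
    refine ⟨h1, ?_, h3⟩
    rw [one_mul, ← Real.sqrt_eq_rpow, Real.norm_of_nonneg (Real.sqrt_nonneg L)] at h2
    exact (Real.le_norm_self _).trans h2
  obtain ⟨L₀, hL₀⟩ := Filter.eventually_atTop.1 hev
  refine ⟨a ^ k + γ * S, by positivity, Real.exp (-max L₀ 1), Real.exp_pos _, ?_, ?_⟩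
  · rw [Real.exp_lt_one_iff]
    linarith [le_max_right L₀ 1]
  intro lam hlam hle
  set L := Real.log (1 / lam) with hLdef
  have hlamL : Real.exp (-L) = lam := by
    rw [hLdef, one_div, Real.log_inv, neg_neg, Real.exp_log hlam]
  have hLmax : max L₀ 1 ≤ L := by
    rw [← hlamL, Real.exp_le_exp] at hle
    linarith
  have hL : 0 < L := by linarith [le_max_right L₀ 1]
  obtain ⟨hlog, hsqrt, hcL⟩ := hL₀ L ((le_max_left _ _).trans hLmax)
  set T := L / Real.log L with hTdef
  have hT : 1 ≤ T := by
    rw [hTdef, one_le_div (by linarith)]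
    linarith [Real.log_le_sub_one_of_pos hL]
  set N := ⌊(a * T) ^ k⌋₊ with hN
  have hNle : (N : ℝ) ≤ (a * T) ^ k := Nat.floor_le (by positivity)
  have hterm : ∀ m : ℕ, μ (m + 1) / (μ (m + 1) + lam) ≤
      (if m ∈ Finset.range N then 1 else 0) + γ * (1 / ((m + 1 : ℕ) : ℝ) ^ 2) := by
    intro m
    have hm0 := hμ0 (m + 1) (by omega)
    split_ifs with hm
    · have : μ (m + 1) / (μ (m + 1) + lam) ≤ 1 := by
        rw [div_le_one (by linarith)]
        linarith
      have : 0 ≤ γ * (1 / ((m + 1 : ℕ) : ℝ) ^ 2) := by positivity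
      linarith
    · have hx : (a * T) ^ k ≤ ((m + 1 : ℕ) : ℝ) := by
        refine (Nat.lt_floor_add_one _).le.trans ?_
        rw [Finset.mem_range, not_lt] at hm
        exact_mod_cast Nat.succ_le_succ hm
      have hx1 : (1 : ℝ) ≤ ((m + 1 : ℕ) : ℝ) := by exact_mod_cast Nat.le_add_left 1 m
      have hkey := rpow_neg_supergeometric_le hk hc ha1 ha hL hlog hsqrt hcL hx1 hx
      rw [hlamL] at hkey
      rw [zero_add, div_le_iff₀ (by linarith)]
      have hp : 0 ≤ γ * (1 / ((m + 1 : ℕ) : ℝ) ^ 2) * μ (m + 1) := by positivity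
      have hq := (hdecay (m + 1) (by omega)).trans (mul_le_mul_of_nonneg_left hkey hγ.le)
      linarith
  have hind : HasSum (fun m : ℕ => if m ∈ Finset.range N then (1 : ℝ) else 0) N := by
    have h := hasSum_sum_of_ne_finset_zero (L := .unconditional ℕ) (s := Finset.range N)
      (f := fun m : ℕ => if m ∈ Finset.range N then (1 : ℝ) else 0) (fun m hm => if_neg hm)
    rwa [Finset.sum_ite_mem, Finset.inter_self, Finset.sum_const, Finset.card_range,
      nsmul_eq_mul, mul_one] at h
  have hbound := hind.add (hS.hasSum.mul_left γ)
  have hsummable : Summable fun m : ℕ => μ (m + 1) / (μ (m + 1) + lam) :=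
    hbound.summable.of_nonneg_of_le
      (fun m => div_nonneg (hμ0 _ (by omega)) (by linarith [hμ0 (m + 1) (by omega)])) hterm
  calc ∑' m : ℕ, μ (m + 1) / (μ (m + 1) + lam) ≤ N + γ * S :=
        hasSum_le hterm hsummable.hasSum hbound
    _ ≤ (a * T) ^ k + γ * S * T ^ k :=
        add_le_add hNle (le_mul_of_one_le_right (by positivity) (one_le_pow₀ hT))
    _ = (a ^ k + γ * S) * L ^ k / Real.log L ^ k := by
        rw [mul_div_assoc, ← div_pow, ← hTdef, mul_pow]
        ring
end

section
/- Let N ≥ 1 and let f_1, …, f_N : ℝ → ℝ be functions such that for each i there is a sequence (a_{i,n})_{n≥0} of strictly positive reals with f_i(x) = ∑_{n≥0} a_{i,n} x^n converging for every x ∈ ℝ. Then there exists a sequence (c_n)_{n≥0} of strictly positive reals such that the composition g := f_N ∘ ⋯ ∘ f_1 satisfies g(x) = ∑_{n≥0} c_n x^n for every x ∈ ℝ; in particular all Taylor coefficients g^{(n)}(0)/n! of the composition are strictly positive. -/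
open scoped BigOperators

/-- Iterated composition `f_{N-1} ∘ ⋯ ∘ f_0` of a finite family of functions
(identity for `N = 0`). -/
noncomputable def compFin : (N : ℕ) → (Fin N → ℝ → ℝ) → ℝ → ℝ
  | 0, _ => id
  | N + 1, f => f (Fin.last N) ∘ compFin N (fun i => f i.castSucc)

open PowerSeries in
/-- Powers of a function given by an everywhere convergent power series are given by the powers
of that series. -/
theorem hasSum_coeff_pow {a : ℕ → ℝ} {f : ℝ → ℝ}
    (hf : ∀ x : ℝ, HasSum (fun n => a n * x ^ n) (f x)) (k : ℕ) (x : ℝ) :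
    HasSum (fun n => coeff n (mk a ^ k) * x ^ n) (f x ^ k) := by
  induction k with
  | zero =>
    convert hasSum_ite_eq (0 : ℕ) (1 : ℝ) using 1
    · funext n
      by_cases h : n = 0 <;> simp [coeff_one, h]
    · simp
  | succ k ih =>
    have hcoeff : (fun n => coeff n (mk a ^ (k + 1)) * x ^ n) = fun n =>
        ∑ ij ∈ Finset.HasAntidiagonal.antidiagonal n,
          (coeff ij.1 (mk a ^ k) * x ^ ij.1) * (a ij.2 * x ^ ij.2) := by
      funext n
      rw [pow_succ, coeff_mul, Finset.sum_mul]
      refine Finset.sum_congr rfl fun ij hij => ?_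
      rw [coeff_mk, ← Finset.HasAntidiagonal.mem_antidiagonal.mp hij, pow_add]
      ring
    have hk := ih.summable.norm
    have h1 := (hf x).summable.norm
    rw [hcoeff, pow_succ, ← ih.tsum_eq, ← (hf x).tsum_eq,
      tsum_mul_tsum_eq_tsum_sum_antidiagonal_of_summable_norm hk h1]
    exact (summable_norm_sum_mul_antidiagonal_of_summable_norm hk h1).of_norm.hasSum

open PowerSeries in
theorem coeff_mk_pow_nonneg {a : ℕ → ℝ} (ha : ∀ n, 0 ≤ a n) (k n : ℕ) :
    0 ≤ coeff n (mk a ^ k) := by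
  induction k generalizing n with
  | zero =>
    rw [pow_zero, coeff_one]
    split_ifs <;> norm_num
  | succ k ih =>
    rw [pow_succ, coeff_mul]
    exact Finset.sum_nonneg fun ij _ => mul_nonneg (ih _) (by simpa using ha _)

open PowerSeries in
/-- The composition of two functions given by everywhere convergent power series with positive
coefficients is again given by such a series. -/
theorem exists_pos_hasSum_comp {a b : ℕ → ℝ} {f g : ℝ → ℝ}
    (ha : ∀ n, 0 < a n) (hb : ∀ n, 0 < b n)
    (hf : ∀ x : ℝ, HasSum (fun n => a n * x ^ n) (f x))
    (hg : ∀ x : ℝ, HasSum (fun n => b n * x ^ n) (g x)) :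
    ∃ c : ℕ → ℝ, (∀ n, 0 < c n) ∧
      ∀ x : ℝ, HasSum (fun n => c n * x ^ n) ((g ∘ f) x) := by
  have hp := coeff_mk_pow_nonneg fun n => (ha n).le
  have hrow (x : ℝ) (k : ℕ) :
      HasSum (fun n => b k * (coeff n (mk a ^ k) * x ^ n)) (b k * f x ^ k) :=
    (hasSum_coeff_pow hf k x).mul_left (b k)
  have hsum (x : ℝ) :
      Summable fun q : ℕ × ℕ => b q.1 * (coeff q.2 (mk a ^ q.1) * x ^ q.2) := by
    refine Summable.of_norm ?_
    have habs : (fun q : ℕ × ℕ => ‖b q.1 * (coeff q.2 (mk a ^ q.1) * x ^ q.2)‖) =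
        fun q => b q.1 * (coeff q.2 (mk a ^ q.1) * |x| ^ q.2) := by
      funext q
      rw [norm_mul, norm_mul, norm_pow, Real.norm_of_nonneg (hb _).le,
        Real.norm_of_nonneg (hp _ _), Real.norm_eq_abs]
    rw [habs, summable_prod_of_nonneg fun q =>
      mul_nonneg (hb _).le (mul_nonneg (hp _ _) (by positivity))]
    refine ⟨fun k => (hrow |x| k).summable, ?_⟩
    simpa only [(hrow |x| _).tsum_eq] using (hg (f |x|)).summable
  have hcol (n : ℕ) : Summable fun k => b k * coeff n (mk a ^ k) := by
    simpa using (hsum 1).prod_symm.prod_factor n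
  refine ⟨fun n => ∑' k, b k * coeff n (mk a ^ k), fun n => ?_, fun x => ?_⟩
  · exact (hcol n).tsum_pos (fun k => mul_nonneg (hb k).le (hp k n)) 1
      (by simpa using mul_pos (hb 1) (ha n))
  · have hS := (hsum x).hasSum
    rw [(hS.prod_fiberwise (hrow x)).unique (hg (f x))] at hS
    refine ((Equiv.prodComm ℕ ℕ).hasSum_iff.mpr hS).prod_fiberwise fun n => ?_
    simpa [mul_assoc] using (hcol n).hasSum.mul_right (x ^ n)

/-- A composition of entire functions, each given by a power series on `ℝ` with strictly
positive coefficients, is again given by a power series on `ℝ` with strictly positive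
coefficients. -/
theorem comp_series_pos_coeff (N : ℕ) (hN : 1 ≤ N) (f : Fin N → ℝ → ℝ)
    (a : Fin N → ℕ → ℝ) (ha : ∀ i n, 0 < a i n)
    (hf : ∀ i, ∀ x : ℝ, HasSum (fun n => a i n * x ^ n) (f i x)) :
    ∃ c : ℕ → ℝ, (∀ n, 0 < c n) ∧
      ∀ x : ℝ, HasSum (fun n => c n * x ^ n) (compFin N f x) := by
  induction N, hN using Nat.le_induction with
  | base => exact ⟨a 0, ha 0, hf 0⟩
  | succ N _ ih =>
    obtain ⟨c, hc, hcs⟩ := ih (fun i => f i.castSucc) (fun i => a i.castSucc)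
      (fun i => ha i.castSucc) fun i => hf i.castSucc
    exact exists_pos_hasSum_comp hc (ha (Fin.last N)) hcs (hf (Fin.last N))
end
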